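/- Let X ⊂ int(𝔸) be an essential annular continuum and let α, γ be hairs of V such that no translate α + k with k ≠ 0 intersects γ. If (γ(1))₁ > max(α)₁ + 1, then min(γ)₁ < min(α)₁ + 1. -/

import Mathlib

open Set Function MeasureTheory Filter Topology

noncomputable section

/-- The vertical fiber `[-1,1]`. -/
abbrev II : Set ℝ := Set.Icc (-1 : ℝ) 1

/-- The universal cover `ℝ × [-1,1]` of the annulus. -/
abbrev Strip : Type := ℝ × II

/-- The compact annulus `(ℝ/ℤ) × [-1,1]`. -/
abbrev Ann : Type := AddCircle (1 : ℝ) × II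

/-- The covering projection `π`. -/
def pr (z : Strip) : Ann := ((z.1 : AddCircle (1 : ℝ)), z.2)

/-- The deck transformation `T^k`. -/
def shiftPt (k : ℤ) (z : Strip) : Strip := (z.1 + k, z.2)

/-- `S + k`, the image of `S` under `T^k`. -/
def shiftSet (k : ℤ) (S : Set Strip) : Set Strip := shiftPt k '' S

/-- `f` is isotopic to the identity. -/
def IsotopicToId (f : Ann → Ann) : Prop :=
  ∃ H : ℝ → Ann → Ann, Continuous (fun p : ℝ × Ann => H p.1 p.2) ∧
    (∀ t : ℝ, Function.Bijective (H t)) ∧ H 0 = id ∧ H 1 = f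

/-- `F` is a lift of `f` commuting with the deck transformation. -/
def IsLift (f : Ann → Ann) (F : Strip → Strip) : Prop :=
  (∀ z, pr (F z) = f (pr z)) ∧ (∀ z, F (shiftPt 1 z) = shiftPt 1 (F z))

/-- `X` is an essential annular continuum with complementary components `Um`, `Up`. -/
structure IsEAC (X Um Up : Set Ann) : Prop where
  compact : IsCompact X
  connected : IsConnected X
  inInterior : ∀ p ∈ X, ((p.2 : ℝ)) ∈ Set.Ioo (-1 : ℝ) 1
  hUm : Um = connectedComponentIn Xᶜ ((0 : AddCircle (1 : ℝ)), ⟨-1, le_rfl, by norm_num⟩)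
  hUp : Up = connectedComponentIn Xᶜ ((0 : AddCircle (1 : ℝ)), ⟨1, by norm_num, le_rfl⟩)
  cover : Xᶜ = Um ∪ Up
  ne : Um ≠ Up

/-- An arc `γ : [0,1] → U ∪ {p}` with `γ([0,1)) ⊂ U` and `γ(1) = p`. -/
def IsArcTo (U : Set Strip) (γ : unitInterval → Strip) (p : Strip) : Prop :=
  Continuous γ ∧ Function.Injective γ ∧ (∀ t, t ≠ 1 → γ t ∈ U) ∧ γ 1 = p

/-- `p` is accessible from `U`. -/
def AccFrom (U : Set Strip) (p : Strip) : Prop := ∃ γ, IsArcTo U γ p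

/-- The order `≺` on accessible points, with access arcs starting on `ℝ × {b}`. -/
def PrecB (b : ℝ) (U : Set Strip) (x x' : Strip) : Prop :=
  ∃ γ γ' : unitInterval → Strip,
    IsArcTo U γ x ∧ IsArcTo U γ' x' ∧
    ((γ 0).2 : ℝ) = b ∧ ((γ' 0).2 : ℝ) = b ∧
    Disjoint (range γ) (range γ') ∧ (γ 0).1 < (γ' 0).1

/-- `k = k(x,y)` is the unique integer with `T^k(y) ⪯ x ≺ T^{k+1}(y)`. -/
def AccIdxB (b : ℝ) (U : Set Strip) (x y : Strip) (k : ℤ) : Prop :=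
  (shiftPt k y = x ∨ PrecB b U (shiftPt k y) x) ∧ PrecB b U x (shiftPt (k + 1) y)

/-- `ρ` is the prime end rotation number of the lift `F` as seen from `U`
(access arcs starting at height `b`): `k(Fⁿ(x), y)/n → ρ` for all accessible `x, y`. -/
def PrimeEndRotB (b : ℝ) (U Xt : Set Strip) (F : Strip → Strip) (ρ : ℝ) : Prop :=
  ∀ x ∈ Xt, ∀ y ∈ Xt, AccFrom U x → AccFrom U y →
    ∀ k : ℕ → ℤ, (∀ n : ℕ, AccIdxB b U (F^[n] x) y (k n)) →
      Tendsto (fun n : ℕ => (k n : ℝ) / (n : ℝ)) atTop (𝓝 ρ)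

/-- The measure-theoretic rotation set `ρ_mes(g̃, X)`, where `φ` is the displacement
function of the lift `g̃` (pushed down to the annulus). -/
def rotMes (g : Ann → Ann) (φ : Ann → ℝ) (X : Set Ann) : Set ℝ :=
  {r | ∃ μ : Measure Ann, IsProbabilityMeasure μ ∧ Measure.map g μ = μ ∧
    μ Xᶜ = 0 ∧ ∫ a, φ a ∂μ = r}

/-- A point in the interior of the top boundary segment `(0,1) × {1}`. -/
def topSeg : Strip := ((1 : ℝ) / 2, ⟨1, by norm_num, le_rfl⟩)

/-- `β' = β ∖ {x₀} = {0} × (η, 1]`. -/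
def betaP (η : ℝ) : Set Strip := {z : Strip | z.1 = 0 ∧ η < (z.2 : ℝ)}

/-- `η = max{y : (0,y) ∈ X̃}`. -/
def etaSpec (Xt : Set Strip) (η : ℝ) : Prop :=
  IsGreatest {y : ℝ | ∃ z ∈ Xt, z.1 = 0 ∧ (z.2 : ℝ) = y} η

/-- The fundamental region `V`: the closure, relative to `Ũ₊`, of the connected
component of `Ũ₊ ∖ (β' ∪ (β' + 1))` containing the segment `(0,1) × {1}`. -/
def Vset (Utp : Set Strip) (η : ℝ) : Set Strip :=
  Utp ∩ closure (connectedComponentIn (Utp \ (betaP η ∪ shiftSet 1 (betaP η))) topSeg)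

/-- A hair of `W`: an arc in `W` starting on `ℝ × {1}`. -/
def IsHair (W : Set Strip) (γ : unitInterval → Strip) : Prop :=
  Continuous γ ∧ Function.Injective γ ∧ ((γ 0).2 : ℝ) = 1 ∧ ∀ t, γ t ∈ W

/-- `(γ)₁`, the projection of the image of `γ` to the first coordinate. -/
def proj1 (γ : unitInterval → Strip) : Set ℝ := range fun t => (γ t).1

/-- `(V + k)⁻ = ⋃_{j ≤ k} (V + j)`. -/
def VMinus (k : ℤ) (V : Set Strip) : Set Strip := ⋃ j ∈ Iic k, shiftSet j V

/-- `(V + k)⁺ = ⋃_{j ≥ k} (V + j)`. -/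
def VPlus (k : ℤ) (V : Set Strip) : Set Strip := ⋃ j ∈ Ici k, shiftSet j V

/-- A crosscut of `Ũ₊`: an arc with endpoints on `X̃` and interior in `Ũ₊`. -/
def IsCrosscut (Utp Xt : Set Strip) (c : unitInterval → Strip) : Prop :=
  Continuous c ∧ Function.Injective c ∧ c 0 ∈ Xt ∧ c 1 ∈ Xt ∧
    ∀ t, t ≠ 0 → t ≠ 1 → c t ∈ Utp

/-- `F^n` for `n : ℤ`. -/
def iterZ (F : Strip ≃ₜ Strip) (n : ℤ) : Strip → Strip := fun z => (F.toEquiv ^ n) z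

end

/-! ### Lifting through the exponential -/

lemma hs_exp_const {Y : Type*} [TopologicalSpace Y] [PreconnectedSpace Y] (u : Y → ℂ)
    (hu : Continuous u) (h : ∀ a b, Complex.exp (u a) = Complex.exp (u b)) (a b : Y) :
    u a = u b :=
  Complex.isCoveringMap_exp.const_of_comp hu (fun a b => Subtype.ext (h a b)) a b

lemma hs_lift_plane (f : ℝ × ℝ → ℂ) (hf : Continuous f) (h0 : ∀ p, f p ≠ 0) :
    ∃ L : ℝ × ℝ → ℂ, Continuous L ∧ ∀ p, Complex.exp (L p) = f p := by
  obtain ⟨F, ⟨-, hF⟩, -⟩ := Complex.isCoveringMapOn_exp.existsUnique_continuousMap_lifts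
    (⟨f, hf⟩ : C(ℝ × ℝ, ℂ)) (a₀ := (0, 0)) (e₀ := Complex.log (f (0, 0)))
    (Complex.exp_log (h0 _)) (fun a => h0 a)
  exact ⟨F, F.continuous, fun p => congrFun hF p⟩

lemma hs_lift_homotopy {Y : Type*} [TopologicalSpace Y] (H : unitInterval × Y → ℂ)
    (hH : Continuous H) (h0 : ∀ p, H p ≠ 0) (f : Y → ℂ) (hf : Continuous f)
    (hf0 : ∀ y, Complex.exp (f y) = H (0, y)) :
    ∃ Λ : unitInterval × Y → ℂ, Continuous Λ ∧ (∀ p, Complex.exp (Λ p) = H p) ∧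
      ∀ y, Λ (0, y) = f y := by
  let H' : C(unitInterval × Y, {z : ℂ // z ≠ 0}) := ⟨fun p => ⟨H p, h0 p⟩, by fun_prop⟩
  have hH0 : ∀ a, H' (0, a) = (fun z : ℂ ↦ (⟨_, z.exp_ne_zero⟩ : {z : ℂ // z ≠ 0}))
      ((⟨f, hf⟩ : C(Y, ℂ)) a) := fun a => Subtype.ext (hf0 a).symm
  refine ⟨Complex.isCoveringMap_exp.liftHomotopy H' ⟨f, hf⟩ hH0, ContinuousMap.continuous _, ?_, ?_⟩
  · intro p
    exact congrArg Subtype.val (congrFun (Complex.isCoveringMap_exp.liftHomotopy_lifts H' ⟨f, hf⟩ hH0) p)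
  · intro y
    exact Complex.isCoveringMap_exp.liftHomotopy_zero H' ⟨f, hf⟩ hH0 y

/-! ### The crossing lemma -/

lemma hs_stay (θ : ℝ → ℝ) (hθ : Continuous θ) (a b : ℝ) (hab : a < b)
    (h : ∀ t, θ t ∉ Ioo a b) (u v : ℝ) (hu : b ≤ θ u) : b ≤ θ v := by
  by_contra hv
  push Not at hv
  have hva : θ v ≤ a := by
    by_contra h'
    exact h v ⟨not_le.mp h', hv⟩
  have := mem_range_of_exists_le_of_exists_ge hθ (c := (a + b) / 2) ⟨v, by linarith⟩
    ⟨u, by linarith⟩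
  obtain ⟨t, ht⟩ := this
  exact h t ⟨by rw [ht]; linarith, by rw [ht]; linarith⟩

lemma hs_cross (g a : ℝ → ℂ) (hg : Continuous g) (ha : Continuous a) (T : ℝ)
    (h0 : (g 0).re < (a 0).re) (h0' : (g 0).im = (a 0).im)
    (hgi : ∀ s, (g s).im ≤ (a 0).im) (hai : ∀ t, (a t).im ≤ (g 0).im)
    (har : ∀ t, (a t).re < (g 1).re) (hgr : ∀ s, (a T).re ≤ (g s).re) :
    ∃ s t, g s = a t := by
  by_contra hne
  push Not at hne
  obtain ⟨L, hL, hLe⟩ := hs_lift_plane (fun p => g p.1 - a p.2) (by fun_prop)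
    (fun p => sub_ne_zero.mpr (hne _ _))
  have hre : ∀ s t, (g s).re - (a t).re = Real.exp (L (s, t)).re * Real.cos (L (s, t)).im := by
    intro s t
    have := congrArg Complex.re (hLe (s, t))
    rw [Complex.exp_re] at this
    simpa using this.symm
  have him : ∀ s t, (g s).im - (a t).im = Real.exp (L (s, t)).re * Real.sin (L (s, t)).im := by
    intro s t
    have := congrArg Complex.im (hLe (s, t))
    rw [Complex.exp_im] at this
    simpa using this.symm
  set A0 := (L (0, 0)).im with hA0
  have e1 : Real.sin A0 = 0 := by
    have := him 0 0
    rw [h0', sub_self] at this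
    rcases mul_eq_zero.mp this.symm with h | h
    · exact absurd h (Real.exp_ne_zero _)
    · exact h
  have e2 : Real.cos A0 = -1 := by
    have h := hre 0 0
    have h' : Real.cos A0 < 0 := by
      by_contra hc
      push Not at hc
      have := mul_nonneg (Real.exp_pos (L (0, 0)).re).le hc
      linarith
    rcases Real.sin_eq_zero_iff_cos_eq.mp e1 with h | h
    · linarith
    · exact h
  set B : ℝ → ℝ → ℝ := fun s t => (L (s, t)).im - A0 - Real.pi with hB
  have hcos : ∀ s t, Real.cos (L (s, t)).im = Real.cos (B s t) := by
    intro s t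
    have : (L (s, t)).im = B s t + (A0 + Real.pi) := by simp [hB]
    rw [this, Real.cos_add, Real.cos_add_pi, Real.sin_add_pi, e1, e2]; ring
  have hsin : ∀ s t, Real.sin (L (s, t)).im = Real.sin (B s t) := by
    intro s t
    have : (L (s, t)).im = B s t + (A0 + Real.pi) := by simp [hB]
    rw [this, Real.sin_add, Real.cos_add_pi, Real.sin_add_pi, e1, e2]; ring
  have hpi := Real.pi_pos
  have hc1 : ∀ t, Continuous fun s => B s t := by intro t; simp only [hB]; fun_prop
  have hc2 : ∀ s, Continuous fun t => B s t := by intro t; simp only [hB]; fun_prop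
  have b00 : B 0 0 = -Real.pi := by simp [hB, hA0]
  -- side `t = 0`
  have s1 : ∀ s, B s 0 ∉ Ioo (-(2 * Real.pi)) (-Real.pi) := by
    rintro s ⟨h, h'⟩
    have h1 := him s 0
    have h2 := hgi s
    have h3 : 0 < Real.sin (B s 0) := by
      rw [← Real.sin_add_two_pi]
      exact Real.sin_pos_of_pos_of_lt_pi (by linarith) (by linarith)
    rw [hsin] at h1
    have := mul_pos (Real.exp_pos (L (s, 0)).re) h3
    linarith
  have b10 : -Real.pi ≤ B 1 0 := hs_stay _ (hc1 0) _ _ (by linarith) s1 0 1 (by linarith)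
  -- side `s = 1`
  have s2 : ∀ t, B 1 t ∉ Ioo (-(3 * Real.pi / 2)) (-(Real.pi / 2)) := by
    rintro t ⟨h, h'⟩
    have h1 := hre 1 t
    have h2 := har t
    have h3 : Real.cos (B 1 t) < 0 := by
      rw [← Real.cos_neg]
      exact Real.cos_neg_of_pi_div_two_lt_of_lt (by linarith) (by linarith)
    rw [hcos] at h1
    have := mul_neg_of_pos_of_neg (Real.exp_pos (L (1, t)).re) h3
    linarith
  have b10' : -(Real.pi / 2) ≤ B 1 0 := by
    by_contra h
    push Not at h
    exact s2 0 ⟨by linarith, h⟩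
  have b1T : -(Real.pi / 2) ≤ B 1 T := hs_stay _ (hc2 1) _ _ (by linarith) s2 0 T b10'
  -- side `t = T`
  have s3 : ∀ s, B s T ∉ Ioo (-(3 * Real.pi / 2)) (-(Real.pi / 2)) := by
    rintro s ⟨h, h'⟩
    have h1 := hre s T
    have h2 := hgr s
    have h3 : Real.cos (B s T) < 0 := by
      rw [← Real.cos_neg]
      exact Real.cos_neg_of_pi_div_two_lt_of_lt (by linarith) (by linarith)
    rw [hcos] at h1
    have := mul_neg_of_pos_of_neg (Real.exp_pos (L (s, T)).re) h3
    linarith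
  have b0T : -(Real.pi / 2) ≤ B 0 T := hs_stay _ (hc1 T) _ _ (by linarith) s3 1 0 b1T
  -- side `s = 0`
  have s4 : ∀ t, B 0 t ∉ Ioo (-Real.pi) 0 := by
    rintro t ⟨h, h'⟩
    have h1 := him 0 t
    have h2 := hai t
    have h3 : Real.sin (B 0 t) < 0 := Real.sin_neg_of_neg_of_neg_pi_lt h' h
    rw [hsin] at h1
    have := mul_neg_of_pos_of_neg (Real.exp_pos (L (0, t)).re) h3
    linarith
  have b0T' : 0 ≤ B 0 T := by
    by_contra h
    push Not at h
    exact s4 T ⟨by linarith, h⟩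
  have := hs_stay _ (hc2 0) _ _ (by linarith) s4 T 0 b0T'
  linarith

/-! ### Branches of the logarithm -/

lemma hs_arg_bounds {u : ℂ} (hu : 0 < u.im) : 0 < u.arg ∧ u.arg < Real.pi := by
  have h1 : 0 ≤ u.arg := Complex.arg_nonneg_iff.mpr hu.le
  have h2 := Complex.arg_le_pi u
  constructor
  · rcases h1.lt_or_eq with h | h
    · exact h
    · have := Complex.arg_eq_zero_iff.mp h.symm
      linarith [this.2]
  · rcases h2.lt_or_eq with h | h
    · exact h
    · have := Complex.arg_eq_pi_iff.mp h
      linarith [this.2]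

/-- logarithm with cut along the downward ray -/
lemma hs_log_down {u : ℂ} (hu : 0 < u.im) :
    Complex.log (-Complex.I * u) + Complex.I * (Real.pi / 2) = Complex.log u := by
  have h0 : u ≠ 0 := by rintro rfl; simp at hu
  obtain ⟨h1, h2⟩ := hs_arg_bounds hu
  have : -Complex.I * u = Complex.exp (Complex.log u - Complex.I * (Real.pi / 2)) := by
    rw [Complex.exp_sub, Complex.exp_log h0, mul_comm Complex.I, Complex.exp_pi_div_two_mul_I,
      Complex.div_I]
    ring
  have hi : (Complex.log u - Complex.I * (Real.pi / 2)).im = u.arg - Real.pi / 2 := by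
    simp [Complex.log_im]
  rw [this, Complex.log_exp (by rw [hi]; linarith) (by rw [hi]; linarith)]
  ring

/-- logarithm with cut along the upward ray, right quadrant -/
lemma hs_log_up_right {u : ℂ} (hu : 0 < u.im) (hr : 0 < u.re) :
    Complex.log (Complex.I * u) - Complex.I * (Real.pi / 2) = Complex.log u := by
  have h0 : u ≠ 0 := by rintro rfl; simp at hu
  obtain ⟨h1, h2⟩ := hs_arg_bounds hu
  have h3 : u.arg < Real.pi / 2 :=
    (abs_lt.mp (Complex.abs_arg_lt_pi_div_two_iff.mpr (Or.inl hr))).2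
  have : Complex.I * u = Complex.exp (Complex.log u + Complex.I * (Real.pi / 2)) := by
    rw [Complex.exp_add, Complex.exp_log h0, mul_comm Complex.I, mul_comm Complex.I,
      Complex.exp_pi_div_two_mul_I]
  have hi : (Complex.log u + Complex.I * (Real.pi / 2)).im = u.arg + Real.pi / 2 := by
    simp [Complex.log_im]
  rw [this, Complex.log_exp (by rw [hi]; linarith) (by rw [hi]; linarith)]
  ring

/-- logarithm with cut along the upward ray, left quadrant -/
lemma hs_log_up_left {u : ℂ} (hu : 0 < u.im) (hr : u.re < 0) :
    Complex.log (Complex.I * u) - Complex.I * (Real.pi / 2) =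
      Complex.log u - 2 * Real.pi * Complex.I := by
  have h0 : u ≠ 0 := by rintro rfl; simp at hu
  obtain ⟨h1, h2⟩ := hs_arg_bounds hu
  have h3 : Real.pi / 2 < u.arg := by
    by_contra h
    push Not at h
    have : |u.arg| ≤ Real.pi / 2 := abs_le.mpr ⟨by linarith [Real.pi_pos], h⟩
    have := Complex.abs_arg_le_pi_div_two_iff.mp this
    linarith
  have : Complex.I * u = Complex.exp (Complex.log u + Complex.I * (Real.pi / 2)
      - 2 * Real.pi * Complex.I) := by
    rw [Complex.exp_sub, Complex.exp_two_pi_mul_I, Complex.exp_add, Complex.exp_log h0,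
      mul_comm Complex.I, mul_comm Complex.I, Complex.exp_pi_div_two_mul_I, div_one]
  have hi : (Complex.log u + Complex.I * (Real.pi / 2) - 2 * Real.pi * Complex.I).im
      = u.arg + Real.pi / 2 - 2 * Real.pi := by
    simp [Complex.log_im]
  rw [this, Complex.log_exp (by rw [hi]; linarith) (by rw [hi]; linarith)]
  ring

/-! ### Basic facts on the covering -/

instance hs_lpc_II : LocallyPathConnectedSpace II :=
  (convex_Icc (-1 : ℝ) 1).locallyPathConnectedSpace

instance hs_lpc_circle : LocallyPathConnectedSpace (AddCircle (1 : ℝ)) :=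
  inferInstanceAs (LocallyPathConnectedSpace (Quotient _))

lemma hs_pr_cont : Continuous pr := by
  unfold pr
  exact ((AddCircle.continuous_mk' (1 : ℝ)).comp continuous_fst).prodMk continuous_snd

lemma hs_pr_open : IsOpenMap pr := by
  have : IsOpenMap (Prod.map (fun x : ℝ => (x : AddCircle (1 : ℝ))) (id : II → II)) :=
    (QuotientAddGroup.isOpenMap_coe).prodMap IsOpenMap.id
  exact this

lemma hs_pr_surj : Function.Surjective pr := by
  rintro ⟨a, b⟩
  obtain ⟨x, rfl⟩ := QuotientAddGroup.mk_surjective a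
  exact ⟨(x, b), rfl⟩

lemma hs_pr_shift (k : ℤ) (z : Strip) : pr (shiftPt k z) = pr z := by
  have : ((k : ℝ) : AddCircle (1 : ℝ)) = 0 := (AddCircle.coe_eq_zero_iff (1 : ℝ)).mpr ⟨k, by simp⟩
  unfold pr shiftPt
  ext1
  · show ((z.1 + k : ℝ) : AddCircle (1 : ℝ)) = (z.1 : AddCircle (1 : ℝ))
    rw [AddCircle.coe_add, this, add_zero]
  · rfl

lemma hs_pr_eq {z z' : Strip} (h : pr z = pr z') : ∃ k : ℤ, z' = shiftPt k z := by
  have h1 : ((z.1 : ℝ) : AddCircle (1 : ℝ)) = (z'.1 : AddCircle (1 : ℝ)) := congrArg Prod.fst h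
  have h2 : z.2 = z'.2 := congrArg (fun p : Ann => p.2) h
  have h3 : ((z'.1 - z.1 : ℝ) : AddCircle (1 : ℝ)) = 0 := by
    rw [AddCircle.coe_sub, h1, sub_self]
  obtain ⟨k, hk⟩ := (AddCircle.coe_eq_zero_iff (1 : ℝ)).mp h3
  refine ⟨k, Prod.ext ?_ h2.symm⟩
  show z'.1 = z.1 + k
  simp at hk
  linarith

lemma hs_shift_cont (k : ℤ) : Continuous (shiftPt k) := by
  unfold shiftPt; fun_prop

/-! ### Orbit sums -/

/-- Sum of `h` over the orbit of `z`. -/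
noncomputable def hsSum {M : Type*} [AddCommMonoid M] (h : Strip → M) (z : Strip) : M :=
  ∑ᶠ k : ℤ, h (shiftPt k z)

lemma hs_sum_periodic {M : Type*} [AddCommMonoid M] (h : Strip → M) (m : ℤ) (z : Strip) :
    hsSum h (shiftPt m z) = hsSum h z := by
  unfold hsSum
  rw [← finsum_comp_equiv (Equiv.addRight (-m))]
  refine finsum_congr fun k => ?_
  congr 1
  unfold shiftPt
  ext1
  · simp; ring
  · rfl

lemma hs_support {M : Type*} [AddCommMonoid M] (h : Strip → M) (R : ℝ)
    (hR : ∀ z : Strip, R < |z.1| → h z = 0) (z : Strip) (B : ℝ) (hz : |z.1| ≤ B) :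
    Function.support (fun k : ℤ => h (shiftPt k z)) ⊆ (Finset.Icc (-⌈R + B⌉) ⌈R + B⌉ : Finset ℤ) := by
  intro k hk
  by_contra hk'
  apply hk
  apply hR
  have h1 : (R + B : ℝ) ≤ ⌈R + B⌉ := Int.le_ceil _
  have h2 : (⌈R + B⌉ : ℝ) < |(k : ℝ)| := by
    have : ⌈R + B⌉ < |k| := by
      by_contra hh
      push Not at hh
      apply hk'
      rw [Finset.mem_coe, Finset.mem_Icc]
      exact abs_le.mp hh
    exact_mod_cast this
  have h3 : |(k : ℝ)| ≤ |z.1 + k| + |z.1| := by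
    have : (k : ℝ) = (z.1 + k) - z.1 := by ring
    calc |(k : ℝ)| = |(z.1 + k) - z.1| := by rw [← this]
      _ ≤ _ := abs_sub _ _
  show R < |z.1 + k|
  linarith

lemma hs_sum_cont {M : Type*} [AddCommMonoid M] [TopologicalSpace M] [ContinuousAdd M]
    (X : Set Ann) (h : Strip → M) (R : ℝ)
    (hR : ∀ z : Strip, R < |z.1| → h z = 0) (hc : ContinuousOn h (pr ⁻¹' X)) :
    ContinuousOn (hsSum h) (pr ⁻¹' X) := by
  rw [continuousOn_iff_continuous_domRestrict]
  refine continuous_finsum (f := fun (k : ℤ) (z : pr ⁻¹' X) => h (shiftPt k z.1)) ?_ ?_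
  · intro k
    refine hc.comp_continuous ((hs_shift_cont k).comp continuous_subtype_val) ?_
    intro z
    show pr (shiftPt k z) ∈ X
    rw [hs_pr_shift]; exact z.2
  · intro z
    refine ⟨{y | |y.1.1| < |z.1.1| + 1}, ?_, ?_⟩
    · refine IsOpen.mem_nhds ?_ ?_
      · exact isOpen_lt (by fun_prop) continuous_const
      · simp
    · refine (Finset.finite_toSet (Finset.Icc (-⌈R + (|z.1.1| + 1)⌉) ⌈R + (|z.1.1| + 1)⌉)).subset ?_
      rintro k ⟨y, hy1, hy2⟩
      exact hs_support h R hR y.1 _ (le_of_lt hy2) hy1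

lemma hs_descend {M : Type*} [TopologicalSpace M] (X : Set Ann) (F : Strip → M)
    (hp : ∀ (m : ℤ) z, F (shiftPt m z) = F z) (hc : ContinuousOn F (pr ⁻¹' X)) :
    ∃ f : Ann → M, ContinuousOn f X ∧ ∀ z, f (pr z) = F z := by
  have key : ∀ z, F (Function.surjInv hs_pr_surj (pr z)) = F z := by
    intro z
    obtain ⟨k, hk⟩ := hs_pr_eq (Function.surjInv_eq hs_pr_surj (pr z))
    conv_rhs => rw [hk, hp]
  refine ⟨fun p => F (Function.surjInv hs_pr_surj p), ?_, key⟩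
  intro p hpX
  obtain ⟨z, rfl⟩ := hs_pr_surj p
  have h1 : Tendsto F (𝓝[pr ⁻¹' X] z) (𝓝 (F z)) := hc z hpX
  show Tendsto _ _ (𝓝 (F (Function.surjInv hs_pr_surj (pr z))))
  rw [key]
  have h2 : 𝓝[X] (pr z) = map pr (𝓝[pr ⁻¹' X] z) := by
    unfold nhdsWithin
    rw [← Filter.comap_principal, Filter.push_pull, hs_pr_open.map_nhds_eq hs_pr_cont.continuousAt]
  rw [h2, tendsto_map'_iff]
  refine h1.congr fun y => (key y).symm

/-! ### An essential continuum has no compactly supported integer cocycle -/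

lemma hs_no_c (X Um Up : Set Ann) (hX : IsEAC X Um Up) (c : Strip → ℤ) (R : ℝ)
    (hR : ∀ z : Strip, R < |z.1| → c z = 0) (hc : ContinuousOn c (pr ⁻¹' X))
    (hnn : ∀ z, 0 ≤ c z) (z0 : Strip) (hz0 : pr z0 ∈ X) (hpos : 0 < c z0) : False := by
  classical
  have hXc : IsClosed X := hX.compact.isClosed
  have hUmo : IsOpen Um := by rw [hX.hUm]; exact hXc.isOpen_compl.connectedComponentIn
  have hUpo : IsOpen Up := by rw [hX.hUp]; exact hXc.isOpen_compl.connectedComponentIn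
  have hdisj : Disjoint Um Up := by
    by_contra h
    apply hX.ne
    rw [hX.hUm, hX.hUp] at h ⊢
    obtain ⟨p, hp1, hp2⟩ := Set.not_disjoint_iff.mp h
    rw [connectedComponentIn_eq hp1, connectedComponentIn_eq hp2]
  have hcirc : ∀ (b : II) (x : AddCircle (1 : ℝ)), (b : ℝ) ∉ Ioo (-1 : ℝ) 1 →
      (x, b) ∈ connectedComponentIn Xᶜ ((0 : AddCircle (1 : ℝ)), b) := by
    intro b x hb
    have h1 : IsPreconnected (range fun x : AddCircle (1 : ℝ) => (x, b)) :=
      isPreconnected_range (by fun_prop)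
    refine h1.subset_connectedComponentIn ⟨0, rfl⟩ ?_ ⟨x, rfl⟩
    rintro _ ⟨y, rfl⟩ hy
    exact hb (hX.inInterior _ hy)
  have hbot : ∀ x : AddCircle (1 : ℝ), (x, (⟨-1, le_rfl, by norm_num⟩ : II)) ∈ Um := by
    intro x; rw [hX.hUm]; exact hcirc _ x (by simp)
  have htop : ∀ x : AddCircle (1 : ℝ), (x, (⟨1, by norm_num, le_rfl⟩ : II)) ∉ Um := by
    intro x hx
    have : (x, (⟨1, by norm_num, le_rfl⟩ : II)) ∈ Up := by
      rw [hX.hUp]; exact hcirc _ x (by simp)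
    exact Set.disjoint_left.mp hdisj hx this
  -- the constant `n`
  obtain ⟨fN, hfN, hfN'⟩ := hs_descend X (hsSum c) (hs_sum_periodic c) (hs_sum_cont X c R hR hc)
  set n : ℤ := hsSum c z0 with hn
  have hfin : ∀ z, (Function.support (fun k : ℤ => c (shiftPt k z))).Finite := fun z =>
    (Finset.finite_toSet _).subset (hs_support c R hR z |z.1| le_rfl)
  have hnpos : 0 < n := by
    have h1 : c (shiftPt 0 z0) ≤ n := by
      rw [hn]
      exact single_le_finsum (f := fun k : ℤ => c (shiftPt k z0)) 0 (hfin z0) (fun k => hnn _)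
    have h2 : shiftPt 0 z0 = z0 := by unfold shiftPt; simp
    rw [h2] at h1
    omega
  have hN : ∀ z, pr z ∈ X → hsSum c z = n := by
    intro z hz
    rw [← hfN', hn, ← hfN']
    exact hX.connected.isPreconnected.constant hfN hz hz0
  -- the function `φ`
  set h : Strip → ℝ := fun z => z.1 * (c z : ℝ) with hh
  have hhR : ∀ z : Strip, R < |z.1| → h z = 0 := by
    intro z hz; simp [hh, hR z hz]
  have hcR : ContinuousOn (fun z => (c z : ℝ)) (pr ⁻¹' X) :=
    (continuous_of_discreteTopology (f := fun m : ℤ => (m : ℝ))).comp_continuousOn hc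
  have hhc : ContinuousOn h (pr ⁻¹' X) := continuous_fst.continuousOn.mul hcR
  obtain ⟨φ, hφ, hφ'⟩ := hs_descend X (hsSum h) (hs_sum_periodic h) (hs_sum_cont X h R hhR hhc)
  have hint : ∀ z, pr z ∈ X → ∃ m : ℤ, φ (pr z) = n * z.1 - m := by
    intro z hz
    rw [hφ', ← hN z hz]
    have s1 := hs_support c R hR z |z.1| le_rfl
    have s2 := hs_support h R hhR z |z.1| le_rfl
    unfold hsSum
    rw [finsum_eq_sum_of_support_subset _ s1, finsum_eq_sum_of_support_subset _ s2]
    refine ⟨-∑ k ∈ Finset.Icc (-⌈R + |z.1|⌉) ⌈R + |z.1|⌉, k * c (shiftPt k z), ?_⟩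
    push_cast
    rw [Finset.sum_mul, sub_neg_eq_add, ← Finset.sum_add_distrib]
    refine Finset.sum_congr rfl fun k _ => ?_
    simp only [hh]
    show (z.1 + k) * _ = _
    ring
  -- Tietze
  obtain ⟨Φ, hΦ⟩ := ContinuousMap.exists_restrict_eq hXc
    (⟨X.domRestrict φ, continuousOn_iff_continuous_domRestrict.mp hφ⟩ : C(X, ℝ))
  have hΦ' : ∀ p ∈ X, Φ p = φ p := fun p hp => congrArg (fun f : C(X, ℝ) => f ⟨p, hp⟩) hΦ
  have hle : (-1 : ℝ) ≤ 1 := by norm_num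
  set P : ℝ × ℝ → Ann := fun p => pr (p.1, Set.projIcc (-1 : ℝ) 1 hle p.2) with hP
  have hPc : Continuous P := hs_pr_cont.comp (continuous_fst.prodMk
    (continuous_projIcc.comp continuous_snd))
  set E : ℝ × ℝ → ℂ := fun p => 2 * Real.pi * Complex.I * ((n * p.1 - Φ (P p) : ℝ) : ℂ) with hE
  have hEc : Continuous E := by
    have : Continuous fun p : ℝ × ℝ => (n * p.1 - Φ (P p) : ℝ) := by fun_prop
    simp only [hE]
    exact continuous_const.mul (Complex.continuous_ofReal.comp this)
  set g : ℝ × ℝ → ℂ := fun p => if P p ∈ Um then Complex.exp (E p) else 1 with hg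
  have hgc : Continuous g := by
    refine Continuous.if ?_ (Complex.continuous_exp.comp hEc) continuous_const
    intro p hp
    have hfr : P p ∈ frontier Um := hPc.frontier_preimage_subset Um hp
    have hPX : P p ∈ X := by
      by_contra hnX
      have hm : P p ∈ Um ∪ Up := hX.cover ▸ hnX
      rw [hUmo.frontier_eq] at hfr
      rcases hm with hm | hm
      · exact hfr.2 hm
      · obtain ⟨q, hq1, hq2⟩ := mem_closure_iff.mp hfr.1 Up hUpo hm
        exact Set.disjoint_left.mp hdisj hq2 hq1
    obtain ⟨m, hm⟩ := hint _ hPX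
    rw [Complex.exp_eq_one_iff]
    refine ⟨m, ?_⟩
    simp only [hE]
    have e : (n * p.1 - Φ (P p) : ℝ) = m := by
      rw [hΦ' _ hPX, hm]; ring
    rw [e]; push_cast; ring
  obtain ⟨L, hLc, hL⟩ := hs_lift_plane g hgc (by
    intro p; simp only [hg]; split_ifs
    · exact Complex.exp_ne_zero _
    · exact one_ne_zero)
  have hPper : ∀ x y, P (x + 1, y) = P (x, y) := by
    intro x y
    have := hs_pr_shift 1 (x, Set.projIcc (-1 : ℝ) 1 hle y)
    simpa [shiftPt] using this
  have hgper : ∀ x y, g (x + 1, y) = g (x, y) := by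
    intro x y
    simp only [hg, hPper]
    split_ifs
    · rw [Complex.exp_eq_exp_iff_exists_int]
      refine ⟨n, ?_⟩
      simp only [hE, hPper]
      push_cast; ring
    · rfl
  have hD := hs_exp_const (fun p : ℝ × ℝ => L (p.1 + 1, p.2) - L p) (by fun_prop) (by
    intro a b
    have : ∀ a : ℝ × ℝ, Complex.exp (L (a.1 + 1, a.2) - L a) = 1 := by
      intro a
      rw [Complex.exp_sub, hL, hL, hgper]
      rw [div_self]
      rw [← hL]; exact Complex.exp_ne_zero _
    rw [this, this]) (0, -1) (0, 1)
  have hP1 : ∀ x, P (x, 1) ∉ Um := by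
    intro x
    simp only [hP]
    rw [Set.projIcc_right]
    exact htop _
  have hP2 : ∀ x, P (x, -1) ∈ Um := by
    intro x
    simp only [hP]
    rw [Set.projIcc_left]
    exact hbot _
  have hT := hs_exp_const (fun x : ℝ => L (x, 1)) (by fun_prop) (by
    intro a b; simp [hL, hg, hP1]) (0 + 1) 0
  have hB := hs_exp_const (fun x : ℝ => L (x, -1) - E (x, -1)) (by fun_prop) (by
    have : ∀ x : ℝ, Complex.exp (L (x, -1) - E (x, -1)) = 1 := by
      intro x
      rw [Complex.exp_sub, hL]
      simp only [hg, hP2, if_true]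
      exact div_self (Complex.exp_ne_zero _)
    intro a b; rw [this, this]) (0 + 1) 0
  simp only at hD hT hB
  rw [hT, sub_self] at hD
  have hE2 : E (0 + 1, -1) - E (0, -1) = 0 := by
    linear_combination hD - hB
  simp only [hE, hPper] at hE2
  have : (2 * Real.pi * Complex.I : ℂ) * n = 0 := by
    rw [← hE2]; push_cast; ring
  rcases mul_eq_zero.mp this with h | h
  · exact Complex.two_pi_I_ne_zero h
  · have : n = 0 := by exact_mod_cast h
    omega

/-! ### No path in the upper domain passes below a point of the continuum -/

/-- The point of the complex plane corresponding to a point of the strip. -/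
noncomputable def hsEmb (z : Strip) : ℂ := ⟨z.1, (z.2 : ℝ)⟩

lemma hs_emb_cont : Continuous hsEmb := by
  have : hsEmb = fun z : Strip => ((z.1 : ℝ) : ℂ) + (((z.2 : ℝ)) : ℂ) * Complex.I := by
    funext z
    apply Complex.ext <;> simp [hsEmb]
  rw [this]
  fun_prop

lemma hs_emb_inj {z z' : Strip} (h : hsEmb z = hsEmb z') : z = z' := by
  have h1 := congrArg Complex.re h
  have h2 := congrArg Complex.im h
  exact Prod.ext h1 (Subtype.ext h2)

lemma hs_no_path (X Um Up : Set Ann) (hX : IsEAC X Um Up) (η : ℝ)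
    (hη : etaSpec (pr ⁻¹' X) η) (b : ℤ) (σ : unitInterval → Strip) (hσ : Continuous σ)
    (hσU : ∀ s, pr (σ s) ∉ X) (hσb : ∀ s, (σ s).1 = b → ((σ s).2 : ℝ) ≤ η)
    (h0 : ((σ 0).2 : ℝ) = 1) (h1 : ((σ 1).2 : ℝ) = 1) (hb0 : (σ 0).1 < b) (hb1 : b < (σ 1).1) :
    False := by
  set Y := {z : Strip // pr z ∈ X}
  have hYlt : ∀ y : Y, ((y.1.2 : ℝ)) < 1 := fun y => (hX.inInterior _ y.2).2
  set H : unitInterval × Y → ℂ := fun p => hsEmb (σ p.1) - hsEmb p.2.1 with hH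
  have hHc : Continuous H := by
    exact (hs_emb_cont.comp (hσ.comp continuous_fst)).sub
      (hs_emb_cont.comp (continuous_subtype_val.comp continuous_snd))
  have hHne : ∀ p, H p ≠ 0 := by
    intro p hp
    have := hs_emb_inj (sub_eq_zero.mp hp)
    apply hσU p.1
    rw [this]; exact p.2.2
  have him0 : ∀ y, 0 < (H (0, y)).im := by
    intro y
    have := hYlt y
    simp only [hH, Complex.sub_im, hsEmb]
    linarith
  have him1 : ∀ y, 0 < (H (1, y)).im := by
    intro y
    have := hYlt y
    simp only [hH, Complex.sub_im, hsEmb]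
    linarith
  have hlog : ∀ s : unitInterval, (∀ y, 0 < (H (s, y)).im) →
      Continuous fun y => Complex.log (H (s, y)) := by
    intro s hs
    refine Continuous.clog (by fun_prop) fun y => ?_
    exact Complex.mem_slitPlane_iff.mpr (Or.inr (hs y).ne')
  obtain ⟨Λ, hΛc, hΛ, hΛ0⟩ := hs_lift_homotopy H hHc hHne (fun y => Complex.log (H (0, y)))
    (hlog 0 him0) (fun y => Complex.exp_log (hHne _))
  have hw : ∀ y, ∃ m : ℤ, Λ (1, y) = Complex.log (H (1, y)) + m * (2 * Real.pi * Complex.I) := by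
    intro y
    rw [← Complex.exp_eq_exp_iff_exists_int, hΛ, Complex.exp_log (hHne _)]
  choose w hw using hw
  have hwc : Continuous w := by
    rw [Int.isClosedEmbedding_coe_real.isEmbedding.continuous_iff]
    have : ((fun m : ℤ => (m : ℝ)) ∘ w) = fun y =>
        (Λ (1, y) - Complex.log (H (1, y))).im / (2 * Real.pi) := by
      funext y
      rw [hw y]
      have := Real.pi_pos
      simp
    rw [this]
    have h2 := hlog 1 him1
    have h3 : Continuous fun y => Λ (1, y) := by fun_prop
    exact (Complex.continuous_im.comp (h3.sub h2)).div_const _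
  -- comparison of lifts along a single path
  have hcomp : ∀ (y : Y) (l : ℂ → ℂ), ContinuousOn l (range fun s => H (s, y)) →
      (∀ s, Complex.exp (l (H (s, y))) = H (s, y)) →
      Λ (1, y) - l (H (1, y)) = Complex.log (H (0, y)) - l (H (0, y)) := by
    intro y l hl hl'
    rw [← hΛ0]
    refine hs_exp_const (fun s : unitInterval => Λ (s, y) - l (H (s, y))) ?_ ?_ 1 0
    · refine Continuous.sub (by fun_prop) ?_
      exact hl.comp_continuous (by fun_prop) fun s => ⟨s, rfl⟩
    · have : ∀ s : unitInterval, Complex.exp (Λ (s, y) - l (H (s, y))) = 1 := by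
        intro s
        rw [Complex.exp_sub, hΛ, hl', div_self (hHne _)]
      intro s t
      rw [this, this]
  have hpi2 : Complex.exp (Complex.I * (Real.pi / 2)) = Complex.I := by
    rw [mul_comm, Complex.exp_pi_div_two_mul_I]
  -- far away
  have hfar : ∀ y : Y, (∀ s, (σ s).1 ≠ y.1.1) → w y = 0 := by
    intro y hy
    have hre : ∀ s, (H (s, y)).re ≠ 0 := fun s => by
      simpa [hH, hsEmb] using sub_ne_zero.mpr (hy s)
    have := hcomp y (fun u => Complex.log (-Complex.I * u) + Complex.I * (Real.pi / 2)) ?_ ?_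
    · simp only [hs_log_down (him0 y), hs_log_down (him1 y), hw y, sub_self,
        add_sub_cancel_left] at this
      rcases mul_eq_zero.mp this with h | h
      · exact_mod_cast h
      · exact absurd h Complex.two_pi_I_ne_zero
    · refine ContinuousOn.add (ContinuousOn.clog (by fun_prop) ?_) continuousOn_const
      rintro _ ⟨s, rfl⟩
      refine Complex.mem_slitPlane_iff.mpr (Or.inr ?_)
      simpa using hre s
    · intro s
      rw [Complex.exp_add, Complex.exp_log (by simp [hHne]), hpi2]
      linear_combination (-H (s, y)) * Complex.I_mul_I
  -- the point above which we pass
  obtain ⟨⟨z, hzX, hz1, hz2⟩, -⟩ := hη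
  have hzbX : pr (shiftPt b z) ∈ X := by rw [hs_pr_shift]; exact hzX
  have hb : w ⟨shiftPt b z, hzbX⟩ = 1 := by
    set y : Y := ⟨shiftPt b z, hzbX⟩ with hy
    have hy1 : y.1.1 = b := by simp [hy, shiftPt, hz1]
    have hy2 : (y.1.2 : ℝ) = η := by simp [hy, shiftPt, hz2]
    have hre : ∀ s, (H (s, y)).re = (σ s).1 - b := fun s => by
      rw [← hy1]; rfl
    have him : ∀ s, (H (s, y)).im = (σ s).2 - η := fun s => by
      rw [← hy2]; rfl
    have hslit : ∀ s, Complex.I * H (s, y) ∈ Complex.slitPlane := by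
      intro s
      rw [Complex.mem_slitPlane_iff]
      by_cases hs : (σ s).1 = b
      · left
        have h2 := hσb s hs
        have h3 : (H (s, y)).im ≠ 0 := by
          intro h3
          exact hHne (s, y) (Complex.ext (by rw [hre, hs]; simp) h3)
        rw [him] at h3
        have : ((σ s).2 : ℝ) - η < 0 := lt_of_le_of_ne (by linarith) h3
        simp [him, Complex.mul_re]
        linarith
      · right
        simpa [hre, Complex.mul_im] using sub_ne_zero.mpr hs
    have := hcomp y (fun u => Complex.log (Complex.I * u) - Complex.I * (Real.pi / 2)) ?_ ?_
    · rw [hs_log_up_left (him0 y) (by rw [hre]; linarith),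
        hs_log_up_right (him1 y) (by rw [hre]; linarith), hw y] at this
      have h2 : ((w y : ℂ) - 1) * (2 * Real.pi * Complex.I) = 0 := by linear_combination this
      rcases mul_eq_zero.mp h2 with h | h
      · have := sub_eq_zero.mp h
        exact_mod_cast this
      · exact absurd h Complex.two_pi_I_ne_zero
    · refine ContinuousOn.sub (ContinuousOn.clog (by fun_prop) ?_) continuousOn_const
      rintro _ ⟨s, rfl⟩
      exact hslit s
    · intro s
      rw [Complex.exp_sub, Complex.exp_log (by simp [hHne]), hpi2]
      field_simp
  -- conclusion
  classical
  obtain ⟨R, hR⟩ : ∃ R, ∀ s, |(σ s).1| ≤ R := by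
    obtain ⟨R, hR⟩ := (isCompact_range (f := fun s => |(σ s).1|) (by fun_prop)).bddAbove
    exact ⟨R, fun s => hR ⟨s, rfl⟩⟩
  refine hs_no_c X Um Up hX (fun z => if h : pr z ∈ X then (w ⟨z, h⟩) ^ 2 else 0) R ?_ ?_ ?_
    (shiftPt b z) hzbX ?_
  · intro z hz
    by_cases h : pr z ∈ X
    · have := hfar ⟨z, h⟩ (by
        intro s hs
        have := hR s
        rw [hs] at this
        exact absurd hz (not_lt.mpr this))
      simp [h, this]
    · simp [h]
  · rw [continuousOn_iff_continuous_domRestrict]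
    have : ((pr ⁻¹' X).domRestrict fun z => if h : pr z ∈ X then (w ⟨z, h⟩) ^ 2 else 0)
        = fun y : Y => (w y) ^ 2 := by
      funext y
      exact dif_pos y.2
    rw [this]
    exact hwc.pow 2
  · intro z
    split_ifs
    · positivity
    · exact le_rfl
  · simp [hzbX, hb]

/-! ### Top boundary of the fundamental region -/

lemma hs_V_top (X Um Up : Set Ann) (hX : IsEAC X Um Up) (η : ℝ)
    (hη : etaSpec (pr ⁻¹' X) η) (z : Strip) (hz : z ∈ Vset (pr ⁻¹' Up) η)
    (hz1 : (z.2 : ℝ) = 1) : 0 ≤ z.1 ∧ z.1 ≤ 1 := by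
  have hXc : IsClosed X := hX.compact.isClosed
  have hUpo : IsOpen Up := by rw [hX.hUp]; exact hXc.isOpen_compl.connectedComponentIn
  have hUpX : ∀ p ∈ Up, p ∉ X := by
    intro p hp
    rw [hX.hUp] at hp
    exact connectedComponentIn_subset _ _ hp
  obtain ⟨hzU, hzC⟩ := hz
  have hmem1 : ∀ u : Strip, u ∈ shiftSet 1 (betaP η) ↔ u.1 = 1 ∧ η < (u.2 : ℝ) := by
    intro u
    constructor
    · rintro ⟨v, ⟨h1, h2⟩, rfl⟩
      exact ⟨by simp [shiftPt, h1], h2⟩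
    · rintro ⟨h1, h2⟩
      refine ⟨(0, u.2), ⟨rfl, h2⟩, Prod.ext ?_ rfl⟩
      simp [shiftPt, h1]
  by_contra hcon
  have hz0 : z.1 ≠ 0 := by rintro h; apply hcon; rw [h]; norm_num
  have hz1' : z.1 ≠ 1 := by rintro h; apply hcon; rw [h]; norm_num
  set W : Set Strip := pr ⁻¹' Up \ (betaP η ∪ shiftSet 1 (betaP η)) with hW
  set C := connectedComponentIn W topSeg with hC
  have hzW : z ∈ W := by
    refine ⟨hzU, ?_⟩
    rintro (h | h)
    · exact hz0 h.1
    · exact hz1' ((hmem1 z).mp h).1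
  have hWo : IsOpen W := by
    obtain ⟨⟨v, hvX, hv1, hv2⟩, -⟩ := hη
    have hWeq : W = pr ⁻¹' Up ∩ {u : Strip | (u.1 = 0 ∨ u.1 = 1) ∧ η ≤ (u.2 : ℝ)}ᶜ := by
      ext u
      constructor
      · rintro ⟨huU, hub⟩
        refine ⟨huU, ?_⟩
        rintro ⟨h01, hle⟩
        rcases hle.lt_or_eq with hlt | heq
        · rcases h01 with h | h
          · exact hub (Or.inl ⟨h, hlt⟩)
          · exact hub (Or.inr ((hmem1 u).mpr ⟨h, hlt⟩))
        · apply hUpX _ huU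
          rcases h01 with h | h
          · have : u = v := Prod.ext (by rw [h, hv1]) (Subtype.ext (by rw [hv2, heq]))
            rw [this]; exact hvX
          · have : u = shiftPt 1 v := Prod.ext (by simp [shiftPt, h, hv1])
              (Subtype.ext (by simp [shiftPt, hv2, heq]))
            rw [this, hs_pr_shift]; exact hvX
      · rintro ⟨huU, hub⟩
        refine ⟨huU, ?_⟩
        rintro (h | h)
        · exact hub ⟨Or.inl h.1, h.2.le⟩
        · have h' := (hmem1 u).mp h
          exact hub ⟨Or.inr h'.1, h'.2.le⟩
    rw [hWeq]
    refine (hUpo.preimage hs_pr_cont).inter (isOpen_compl_iff.mpr ?_)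
    refine IsClosed.inter (IsClosed.union ?_ ?_) ?_
    · exact isClosed_eq continuous_fst continuous_const
    · exact isClosed_eq continuous_fst continuous_const
    · exact isClosed_le continuous_const (continuous_subtype_val.comp continuous_snd)
  have htopW : topSeg ∈ W := by
    refine ⟨?_, ?_⟩
    · show pr topSeg ∈ Up
      rw [hX.hUp]
      have h1 : IsPreconnected (range fun x : AddCircle (1 : ℝ) =>
          (x, (⟨1, by norm_num, le_rfl⟩ : II))) :=
        isPreconnected_range (by fun_prop)
      refine h1.subset_connectedComponentIn ⟨0, rfl⟩ ?_ ⟨_, rfl⟩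
      rintro _ ⟨y, rfl⟩ hy
      have := (hX.inInterior _ hy).2
      simp at this
    · rintro (h | h)
      · have := h.1
        norm_num [topSeg] at this
      · have := ((hmem1 _).mp h).1
        norm_num [topSeg] at this
  have hCo : IsOpen C := hWo.connectedComponentIn
  have hCconn : IsConnected C := isConnected_connectedComponentIn_iff.mpr htopW
  have hzinC : z ∈ C := by
    have ho : IsOpen (connectedComponentIn W z) := hWo.connectedComponentIn
    obtain ⟨q, hq1, hq2⟩ := mem_closure_iff.mp hzC _ ho (mem_connectedComponentIn hzW)
    rw [hC, connectedComponentIn_eq hq2, ← connectedComponentIn_eq hq1]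
    exact mem_connectedComponentIn hzW
  have hpc := hCo.isConnected_iff_isPathConnected.mp hCconn
  have htopC : topSeg ∈ C := mem_connectedComponentIn htopW
  have hCW : C ⊆ W := connectedComponentIn_subset _ _
  have ht1 : ((topSeg).2 : ℝ) = 1 := rfl
  have ht0 : (topSeg).1 = 1 / 2 := rfl
  rcases lt_or_ge z.1 0 with hlt | hge
  · obtain ⟨σ, hσ⟩ := hpc.joinedIn z hzinC topSeg htopC
    refine hs_no_path X Um Up hX η hη 0 σ σ.continuous (fun s => hUpX _ (hCW (hσ s)).1) ?_ ?_ ?_ ?_ ?_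
    · intro s hs
      by_contra hc
      exact (hCW (hσ s)).2 (Or.inl ⟨by simpa using hs, not_le.mp hc⟩)
    · rw [σ.source]; exact hz1
    · rw [σ.target]; exact ht1
    · rw [σ.source]; simpa using hlt
    · rw [σ.target, ht0]; norm_num
  · have hgt : 1 < z.1 := by
      by_contra h
      exact hcon ⟨hge, not_lt.mp h⟩
    obtain ⟨σ, hσ⟩ := hpc.joinedIn topSeg htopC z hzinC
    refine hs_no_path X Um Up hX η hη 1 σ σ.continuous (fun s => hUpX _ (hCW (hσ s)).1) ?_ ?_ ?_ ?_ ?_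
    · intro s hs
      by_contra hc
      exact (hCW (hσ s)).2 (Or.inr ((hmem1 _).mpr ⟨by simpa using hs, not_le.mp hc⟩))
    · rw [σ.source]; exact ht1
    · rw [σ.target]; exact hz1
    · rw [σ.source, ht0]; norm_num
    · rw [σ.target]; simpa using hgt

/-- fact `⋆`: for hairs `α, γ` of `V` with `γ` disjoint from all nontrivial
translates of `α`: if `(γ(1))₁ > max(α)₁ + 1` then `min(γ)₁ < min(α)₁ + 1`. -/
theorem hair_star
    (X Um Up : Set Ann) (hX : IsEAC X Um Up)
    (η : ℝ) (hη : etaSpec (pr ⁻¹' X) η)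
    (α γ : unitInterval → Strip)
    (hα : IsHair (Vset (pr ⁻¹' Up) η) α) (hγ : IsHair (Vset (pr ⁻¹' Up) η) γ)
    (hdisj : ∀ k : ℤ, k ≠ 0 → Disjoint (range fun t => shiftPt k (α t)) (range γ))
    (h1 : (γ 1).1 > sSup (proj1 α) + 1) :
    sInf (proj1 γ) < sInf (proj1 α) + 1 := by
  by_contra hcon
  push Not at hcon
  obtain ⟨hαc, -, hα0, hαV⟩ := hα
  obtain ⟨hγc, -, hγ0, hγV⟩ := hγ
  have hα01 := hs_V_top X Um Up hX η hη _ (hαV 0) hα0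
  have hγ01 := hs_V_top X Um Up hX η hη _ (hγV 0) hγ0
  have hKα : IsCompact (proj1 α) := isCompact_range (by fun_prop)
  have hKγ : IsCompact (proj1 γ) := isCompact_range (by fun_prop)
  have hαle : ∀ t, (α t).1 ≤ sSup (proj1 α) := fun t => le_csSup hKα.bddAbove ⟨t, rfl⟩
  have hγge : ∀ t, sInf (proj1 γ) ≤ (γ t).1 := fun t => csInf_le hKγ.bddBelow ⟨t, rfl⟩
  obtain ⟨T, hT⟩ := hKα.sInf_mem (range_nonempty _)
  have hne : ∀ s t, γ s ≠ shiftPt 1 (α t) := by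
    intro s t h
    exact Set.disjoint_left.mp (hdisj 1 one_ne_zero) ⟨t, rfl⟩ ⟨s, h⟩
  have h01 : (γ 0).1 < (α 0).1 + 1 := by
    refine lt_of_le_of_ne (by linarith [hα01.1, hγ01.2]) fun h => hne 0 0 ?_
    refine Prod.ext ?_ (Subtype.ext ?_)
    · simp [shiftPt, h]
    · simp [shiftPt, hα0, hγ0]
  have hle : (0 : ℝ) ≤ 1 := zero_le_one
  set Q : ℝ → unitInterval := Set.projIcc (0 : ℝ) 1 hle with hQ
  have hQc : Continuous Q := continuous_projIcc
  have hQ0 : Q 0 = 0 := Set.projIcc_left hle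
  have hQ1 : Q 1 = 1 := Set.projIcc_right hle
  have hQT : Q T = T := Set.projIcc_val hle T
  obtain ⟨s, t, hst⟩ := hs_cross (fun s => hsEmb (γ (Q s))) (fun t => hsEmb (shiftPt 1 (α (Q t))))
    (hs_emb_cont.comp (hγc.comp hQc))
    (hs_emb_cont.comp ((hs_shift_cont 1).comp (hαc.comp hQc))) T
    (by simpa [hsEmb, shiftPt, hQ0] using h01)
    (by simp [hsEmb, shiftPt, hQ0, hα0, hγ0])
    (by intro s; simpa [hsEmb, shiftPt, hQ0, hα0] using (γ (Q s)).2.2.2)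
    (by intro t; simpa [hsEmb, shiftPt, hQ0, hγ0] using (α (Q t)).2.2.2)
    (by
      intro t
      have := hαle (Q t)
      simp only [hsEmb, shiftPt, hQ1]
      push_cast
      linarith)
    (by
      intro s
      have := hγge (Q s)
      have hT' : (α T).1 = sInf (proj1 α) := hT
      simp only [hsEmb, shiftPt, hQT]
      push_cast
      linarith)
  exact hne _ _ (hs_emb_inj hst)
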